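/- arXiv:1802.10291 — 3 statements merged into one kernel-verified Lean document; each statement's English description precedes it below -/
import Mathlib

section
/- Let N be a natural number and f(t) = Σ_{n=−N}^{N} a(n) e^{int} with a(n) ∈ ℂ (f may be complex-valued). Define y₁(t) = 1 + (1/2) Σ_{n=−N}^{−1} ( e^{i(n+N+1)t} + e^{int} ) and y₂(t) = e^{i(N+1)t} − i + Σ_{n=−N}^{−1} ( −(i/2) e^{int} + (i/2) e^{i(n+N+1)t} ). Then for all t ∈ ℝ, Hf(t) = (1/(N+1)) Σ_{p=0}^{N} [ Hf(t_p) y₁(t − t_p) + ( a(0) − f(t_p) ) y₂(t − t_p) ], where t_p = 2πp/(N+1). -/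
open Real

/-- Pair each negative frequency `n` with the positive frequency `n + N + 1`. -/
theorem sum_Icc_neg_self_eq_add_sum_pairs (N : ℕ) (F : ℤ → ℂ) :
    ∑ k ∈ Finset.Icc (-(N : ℤ)) N, F k =
      F 0 + ∑ n ∈ Finset.Icc (-(N : ℤ)) (-1), (F n + F (n + N + 1)) := by
  have himg : (Finset.Icc (-(N : ℤ)) (-1)).image (fun n : ℤ => n + N + 1) =
      Finset.Icc 1 (N : ℤ) := by
    ext k
    simp only [Finset.mem_image, Finset.mem_Icc]
    constructor
    · rintro ⟨n, hn, rfl⟩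
      omega
    · intro hk
      exact ⟨k - N - 1, by omega, by omega⟩
  have hpos : ∑ n ∈ Finset.Icc (-(N : ℤ)) (-1), F (n + N + 1) =
      ∑ k ∈ Finset.Icc 1 (N : ℤ), F k := by
    rw [← himg, Finset.sum_image]
    intro x _ y _ hxy
    simpa using hxy
  have hunion : Finset.Icc (-(N : ℤ)) N =
      insert 0 (Finset.Icc (-(N : ℤ)) (-1) ∪ Finset.Icc 1 (N : ℤ)) := by
    ext k
    simp only [Finset.mem_insert, Finset.mem_union, Finset.mem_Icc]
    omega
  rw [Finset.sum_add_distrib, hpos, hunion, Finset.sum_insert (by simp), Finset.sum_union]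
  rw [Finset.disjoint_left]
  intro k hk hk'
  rw [Finset.mem_Icc] at hk hk'
  omega

theorem exp_two_pi_mul_int_div_eq_one_iff (N : ℕ) (k : ℤ) :
    Complex.exp (Complex.I * k * (2 * π / (N + 1))) = 1 ↔ ((N : ℤ) + 1) ∣ k := by
  have hN : (N : ℂ) + 1 ≠ 0 := by exact_mod_cast Nat.succ_ne_zero N
  have hpi : (2 * π * Complex.I : ℂ) ≠ 0 := Complex.two_pi_I_ne_zero
  rw [Complex.exp_eq_one_iff]
  refine exists_congr fun m => ?_
  have hrw : Complex.I * k * (2 * π / (N + 1)) = (k : ℂ) / (N + 1) * (2 * π * Complex.I) := by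
    ring
  rw [hrw, mul_left_inj' hpi, div_eq_iff hN, mul_comm (m : ℂ)]
  exact_mod_cast Iff.rfl

theorem sum_exp_equispaced (N : ℕ) (k : ℤ) :
    ∑ p ∈ Finset.range (N + 1), Complex.exp (Complex.I * k * (2 * π * p / (N + 1))) =
      if ((N : ℤ) + 1) ∣ k then (N : ℂ) + 1 else 0 := by
  have hN : (N : ℂ) + 1 ≠ 0 := by exact_mod_cast Nat.succ_ne_zero N
  have hterm : ∀ p : ℕ, Complex.exp (Complex.I * k * (2 * π * p / (N + 1))) =
      Complex.exp (Complex.I * k * (2 * π / (N + 1))) ^ p := by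
    intro p
    rw [← Complex.exp_nat_mul]
    congr 1
    ring
  simp_rw [hterm]
  have hone := exp_two_pi_mul_int_div_eq_one_iff N k
  split_ifs with h
  · simp [hone.2 h]
  · rw [geom_sum_eq (mt hone.1 h), ← Complex.exp_nat_mul]
    have hper : ((N + 1 : ℕ) : ℂ) * (Complex.I * k * (2 * π / (N + 1))) =
        k * (2 * π * Complex.I) := by
      push_cast
      field_simp
    rw [hper, Complex.exp_int_mul_two_pi_mul_I, sub_self, zero_div]

/-- Discrete convolution of a trigonometric polynomial with an exponential sees exactly the
frequencies congruent to that of the exponential. -/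
theorem sum_equispaced_trigPoly_mul_exp (N : ℕ) (c : ℤ → ℂ) (m : ℤ) (t : ℂ) :
    ∑ p ∈ Finset.range (N + 1),
      (∑ k ∈ Finset.Icc (-(N : ℤ)) N, c k * Complex.exp (Complex.I * k * (2 * π * p / (N + 1)))) *
        Complex.exp (Complex.I * m * (t - 2 * π * p / (N + 1))) =
      (N + 1) * Complex.exp (Complex.I * m * t) *
        ∑ k ∈ Finset.Icc (-(N : ℤ)) N, if ((N : ℤ) + 1) ∣ k - m then c k else 0 := by
  simp_rw [Finset.sum_mul]
  rw [Finset.sum_comm, Finset.mul_sum]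
  refine Finset.sum_congr rfl fun k _ => ?_
  have hterm : ∀ p : ℕ, c k * Complex.exp (Complex.I * k * (2 * π * p / (N + 1))) *
      Complex.exp (Complex.I * m * (t - 2 * π * p / (N + 1))) =
      c k * Complex.exp (Complex.I * m * t) *
        Complex.exp (Complex.I * ((k - m : ℤ) : ℂ) * (2 * π * p / (N + 1))) := by
    intro p
    rw [mul_assoc, ← Complex.exp_add, mul_assoc (c k), ← Complex.exp_add]
    congr 2
    push_cast
    ring
  simp_rw [hterm]
  rw [← Finset.mul_sum, sum_exp_equispaced]
  split_ifs <;> ring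

theorem eq_of_dvd_sub_of_abs_lt {M x y : ℤ} (h : M ∣ x - y) (h₁ : x - y < M) (h₂ : -M < x - y) :
    x = y :=
  sub_eq_zero.1 (Int.eq_zero_of_abs_lt_dvd h (abs_lt.2 ⟨h₂, h₁⟩))

theorem sum_aliases_of_dvd (N : ℕ) (c : ℤ → ℂ) {m : ℤ} (hm : ((N : ℤ) + 1) ∣ m) :
    (∑ k ∈ Finset.Icc (-(N : ℤ)) N, if ((N : ℤ) + 1) ∣ k - m then c k else 0) = c 0 := by
  rw [Finset.sum_eq_single_of_mem 0 (by simp)]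
  · rw [if_pos (by simpa using hm)]
  · intro k hk hk0
    rw [Finset.mem_Icc] at hk
    refine if_neg fun h => hk0 ?_
    have hd : ((N : ℤ) + 1) ∣ k - 0 := by simpa using dvd_add h hm
    exact eq_of_dvd_sub_of_abs_lt hd (by omega) (by omega)

theorem sum_aliases_of_dvd_sub (N : ℕ) (c : ℤ → ℂ) {m n : ℤ}
    (hn : n ∈ Finset.Icc (-(N : ℤ)) (-1)) (hm : ((N : ℤ) + 1) ∣ m - n) :
    (∑ k ∈ Finset.Icc (-(N : ℤ)) N, if ((N : ℤ) + 1) ∣ k - m then c k else 0) =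
      c n + c (n + N + 1) := by
  have hcongr : ∀ k : ℤ, ((N : ℤ) + 1) ∣ k - m ↔ ((N : ℤ) + 1) ∣ k - n := by
    intro k
    rw [← sub_add_sub_cancel k m n, dvd_add_left hm]
  have hn' := Finset.mem_Icc.1 hn
  simp_rw [hcongr]
  rw [sum_Icc_neg_self_eq_add_sum_pairs, Finset.sum_eq_single_of_mem n hn, if_neg, if_pos, if_pos,
    zero_add]
  · exact ⟨1, by ring⟩
  · simp
  · intro h
    have := eq_of_dvd_sub_of_abs_lt h (by omega) (by omega)
    omega
  · intro k hk hkn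
    rw [Finset.mem_Icc] at hk
    have hnot : ¬ ((N : ℤ) + 1) ∣ k - n := fun h =>
      hkn (eq_of_dvd_sub_of_abs_lt h (by omega) (by omega))
    have hshift : k + N + 1 - n = k - n + (N + 1) := by ring
    simp only [hshift, dvd_add_self_right, if_neg hnot, add_zero]

/-- Discrete convolution of the samples of a trigonometric polynomial with a kernel having
frequencies in `[-N, N + 1]`. -/
theorem sum_equispaced_trigPoly_mul_kernel (N : ℕ) (c : ℤ → ℂ) (α β γ δ : ℂ) (g y : ℝ → ℂ)
    (hg : ∀ t : ℝ, g t = ∑ k ∈ Finset.Icc (-(N : ℤ)) N, c k * Complex.exp (Complex.I * k * t))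
    (hy : ∀ t : ℝ, y t = α * Complex.exp (Complex.I * ((N : ℂ) + 1) * t) + β +
      ∑ n ∈ Finset.Icc (-(N : ℤ)) (-1), (γ * Complex.exp (Complex.I * n * t) +
        δ * Complex.exp (Complex.I * ((n : ℂ) + N + 1) * t))) (t : ℝ) :
    ∑ p ∈ Finset.range (N + 1),
      g (2 * π * p / (N + 1)) * y (t - 2 * π * p / (N + 1)) =
      (N + 1) * (c 0 * (α * Complex.exp (Complex.I * ((N : ℂ) + 1) * t) + β) +
        ∑ n ∈ Finset.Icc (-(N : ℤ)) (-1), (c n + c (n + N + 1)) *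
          (γ * Complex.exp (Complex.I * n * t) +
            δ * Complex.exp (Complex.I * ((n : ℂ) + N + 1) * t))) := by
  have hconv : ∀ m : ℤ, ∑ p ∈ Finset.range (N + 1), g (2 * π * p / (N + 1)) *
      Complex.exp (Complex.I * m * ((t - 2 * π * p / (N + 1) : ℝ) : ℂ)) =
      (N + 1) * Complex.exp (Complex.I * m * t) *
        ∑ k ∈ Finset.Icc (-(N : ℤ)) N, if ((N : ℤ) + 1) ∣ k - m then c k else 0 := by
    intro m
    rw [← sum_equispaced_trigPoly_mul_exp]
    refine Finset.sum_congr rfl fun p _ => ?_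
    rw [hg]
    push_cast
    rfl
  have hzero := hconv 0
  have htop := hconv (N + 1)
  rw [sum_aliases_of_dvd N c (dvd_zero _)] at hzero
  rw [sum_aliases_of_dvd N c dvd_rfl] at htop
  simp only [Int.cast_zero, mul_zero, zero_mul, Complex.exp_zero, mul_one] at hzero
  simp only [Int.cast_add, Int.cast_natCast, Int.cast_one] at htop
  have hneg : ∀ n ∈ Finset.Icc (-(N : ℤ)) (-1),
      ∑ p ∈ Finset.range (N + 1), g (2 * π * p / (N + 1)) *
        (γ * Complex.exp (Complex.I * n * ((t - 2 * π * p / (N + 1) : ℝ) : ℂ)) +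
          δ * Complex.exp (Complex.I * ((n : ℂ) + N + 1) *
            ((t - 2 * π * p / (N + 1) : ℝ) : ℂ))) =
      (N + 1) * ((c n + c (n + N + 1)) * (γ * Complex.exp (Complex.I * n * t) +
        δ * Complex.exp (Complex.I * ((n : ℂ) + N + 1) * t))) := by
    intro n hn
    have hlow := hconv n
    have hhigh := hconv (n + N + 1)
    rw [sum_aliases_of_dvd_sub N c hn (by simp)] at hlow
    rw [sum_aliases_of_dvd_sub N c hn ⟨1, by ring⟩] at hhigh
    simp only [Int.cast_add, Int.cast_natCast, Int.cast_one] at hhigh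
    simp_rw [mul_add (g _), mul_left_comm (g _) γ, mul_left_comm (g _) δ, Finset.sum_add_distrib,
      ← Finset.mul_sum]
    rw [hlow, hhigh]
    ring
  simp_rw [hy, mul_add (g _), Finset.sum_add_distrib (s := Finset.range (N + 1)),
    mul_left_comm (g _) α]
  rw [← Finset.mul_sum, htop, ← Finset.sum_mul, hzero]
  simp_rw [Finset.mul_sum (Finset.Icc (-(N : ℤ)) (-1))]
  rw [Finset.sum_comm, Finset.sum_congr rfl hneg, ← Finset.mul_sum]
  ring

/-- Example 3.5, formula (22): the circular Hilbert transform of a (possibly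
complex-valued) trigonometric polynomial reconstructed from the samples of the
polynomial and of its Hilbert transform. -/
theorem hilbert_of_complex_signal_from_self_and_hilbert_samples
    (N : ℕ) (a : ℤ → ℂ)
    (f Hf : ℝ → ℂ)
    (hf : ∀ t : ℝ, f t = ∑ n ∈ Finset.Icc (-(N : ℤ)) (N : ℤ),
      a n * Complex.exp (Complex.I * (n : ℂ) * (t : ℂ)))
    (hHf : ∀ t : ℝ, Hf t = ∑ n ∈ Finset.Icc (-(N : ℤ)) (N : ℤ),
      (-Complex.I * ((Int.sign n : ℤ) : ℂ)) * a n * Complex.exp (Complex.I * (n : ℂ) * (t : ℂ)))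
    (y₁ y₂ : ℝ → ℂ)
    (hy₁ : ∀ t : ℝ, y₁ t = 1 + (1 / 2) * ∑ n ∈ Finset.Icc (-(N : ℤ)) (-1 : ℤ),
      (Complex.exp (Complex.I * ((n : ℂ) + (N : ℂ) + 1) * (t : ℂ)) +
       Complex.exp (Complex.I * (n : ℂ) * (t : ℂ))))
    (hy₂ : ∀ t : ℝ, y₂ t = Complex.exp (Complex.I * ((N : ℂ) + 1) * (t : ℂ)) - Complex.I +
      ∑ n ∈ Finset.Icc (-(N : ℤ)) (-1 : ℤ),
        (-(Complex.I / 2) * Complex.exp (Complex.I * (n : ℂ) * (t : ℂ)) +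
         (Complex.I / 2) * Complex.exp (Complex.I * ((n : ℂ) + (N : ℂ) + 1) * (t : ℂ)))) :
    ∀ t : ℝ, Hf t = (1 / ((N : ℂ) + 1)) * ∑ p ∈ Finset.range (N + 1),
      (Hf (2 * π * p / (N + 1)) * y₁ (t - 2 * π * p / (N + 1)) +
       (a 0 - f (2 * π * p / (N + 1))) * y₂ (t - 2 * π * p / (N + 1))) := by
  intro t
  have hN : (N : ℂ) + 1 ≠ 0 := by exact_mod_cast Nat.succ_ne_zero N
  have hH := sum_equispaced_trigPoly_mul_kernel N (fun n => -Complex.I * (n.sign : ℂ) * a n)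
    0 1 (1 / 2) (1 / 2) Hf y₁ hHf (fun t => by
      rw [hy₁, Finset.mul_sum, zero_mul, zero_add]
      congr 1
      exact Finset.sum_congr rfl fun n _ => by ring) t
  have hF := sum_equispaced_trigPoly_mul_kernel N (fun n => if n = 0 then 0 else -a n)
    1 (-Complex.I) (-(Complex.I / 2)) (Complex.I / 2) (fun t => a 0 - f t) y₂ (fun t => by
      rw [hf, sum_Icc_neg_self_eq_add_sum_pairs, sum_Icc_neg_self_eq_add_sum_pairs]
      simp only [Int.cast_zero, mul_zero, zero_mul, Complex.exp_zero, mul_one, if_true, zero_add,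
        sub_add_cancel_left, ← Finset.sum_neg_distrib]
      refine Finset.sum_congr rfl fun n hn => ?_
      rw [Finset.mem_Icc] at hn
      rw [if_neg (by omega), if_neg (by omega)]
      ring) (fun t => by rw [hy₂, one_mul, sub_eq_add_neg]) t
  rw [Finset.sum_add_distrib, hH, hF, ← mul_add, ← mul_assoc, one_div_mul_cancel hN, one_mul, hHf,
    sum_Icc_neg_self_eq_add_sum_pairs]
  simp only [Int.sign_zero, Int.cast_zero, mul_zero, zero_mul, if_true, zero_add]
  rw [← Finset.sum_add_distrib]
  refine Finset.sum_congr rfl fun n hn => ?_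
  rw [Finset.mem_Icc] at hn
  rw [if_neg (by omega), if_neg (by omega), Int.sign_eq_neg_one_of_neg (by omega),
    Int.sign_eq_one_of_pos (by omega)]
  push_cast
  ring
end

section
/- Let N be a natural number and f(t) = Σ_{n=−N}^{N} a(n) e^{int} with a(n) ∈ ℂ. Then a(0) = (1/(N+1)) Σ_{p=0}^{N} ( f(t_p) + i·Hf(t_p) ), where t_p = 2πp/(N+1). -/
open Real

/-- The character `t ↦ exp (i n t)` sums to zero over the `m` equispaced points `2πp/m`
when `0 < n < m`. -/
theorem sum_exp_equispaced_eq_zero {m n : ℕ} (hn : n ≠ 0) (hnm : n < m) :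
    ∑ p ∈ Finset.range m,
      Complex.exp (Complex.I * (n : ℂ) * (2 * (π : ℂ) * p / m)) = 0 := by
  have hζ := Complex.isPrimitiveRoot_exp m (by omega)
  have h : ∀ p ∈ Finset.range m,
      Complex.exp (Complex.I * (n : ℂ) * (2 * (π : ℂ) * p / m)) =
        (Complex.exp (2 * π * Complex.I / m) ^ n) ^ p := by
    intro p _
    rw [← Complex.exp_nat_mul, ← Complex.exp_nat_mul]
    congr 1
    ring
  rw [Finset.sum_congr rfl h, geom_sum_eq (hζ.pow_ne_one_of_pos_of_lt hn hnm), ← pow_mul,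
    mul_comm n m, pow_mul, hζ.pow_eq_one, one_pow, sub_self, zero_div]

/-- Formula (23): the zeroth Fourier coefficient computed from `N+1` equispaced
samples of `f` and of its circular Hilbert transform. -/
theorem zeroth_coefficient_from_self_and_hilbert_samples
    (N : ℕ) (a : ℤ → ℂ)
    (f Hf : ℝ → ℂ)
    (hf : ∀ t : ℝ, f t = ∑ n ∈ Finset.Icc (-(N : ℤ)) (N : ℤ),
      a n * Complex.exp (Complex.I * (n : ℂ) * (t : ℂ)))
    (hHf : ∀ t : ℝ, Hf t = ∑ n ∈ Finset.Icc (-(N : ℤ)) (N : ℤ),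
      (-Complex.I * ((Int.sign n : ℤ) : ℂ)) * a n * Complex.exp (Complex.I * (n : ℂ) * (t : ℂ))) :
    a 0 = (1 / ((N : ℂ) + 1)) * ∑ p ∈ Finset.range (N + 1),
      (f (2 * π * p / (N + 1)) + Complex.I * Hf (2 * π * p / (N + 1))) := by
  have hN : (N : ℂ) + 1 ≠ 0 := Nat.cast_add_one_ne_zero N
  have combine : ∀ t : ℝ, f t + Complex.I * Hf t = ∑ n ∈ Finset.Icc (-(N : ℤ)) (N : ℤ),
      (1 + ((Int.sign n : ℤ) : ℂ)) * a n * Complex.exp (Complex.I * (n : ℂ) * (t : ℂ)) := by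
    intro t
    rw [hf, hHf, Finset.mul_sum, ← Finset.sum_add_distrib]
    refine Finset.sum_congr rfl fun n _ => ?_
    linear_combination (-((Int.sign n : ℤ) : ℂ) * a n *
      Complex.exp (Complex.I * (n : ℂ) * (t : ℂ))) * Complex.I_mul_I
  simp_rw [combine]
  rw [Finset.sum_comm, Finset.sum_eq_single (0 : ℤ)]
  · simp
    field_simp
  · intro n hn hn0
    rw [← Finset.mul_sum]
    rw [Finset.mem_Icc] at hn
    rcases lt_or_gt_of_ne hn0 with h | h
    · simp [Int.sign_eq_neg_one_of_neg h]
    · lift n to ℕ using h.le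
      have := sum_exp_equispaced_eq_zero (m := N + 1) (n := n) (by omega) (by omega)
      push_cast at this ⊢
      rw [this, mul_zero]
  · intro h
    simp at h
end

section
/- Under the MCI setup with H_n invertible for every n ∈ I_1, let f : ℝ → ℂ be 2π-periodic and square-integrable on [0, 2π), with Fourier coefficients a(n) = (1/(2π)) ∫₀^{2π} f(t) e^{−int} dt, and assume Σ_{n∈ℤ} |a(n) b_m(n)| < ∞ for each m = 1,…,M. For τ ∈ ℝ define g_m(t_p, τ) = Σ_{n∈ℤ} a(n) b_m(n) e^{−inτ} e^{in t_p}, the approximant T_N f_τ(t) = (1/L) Σ_{m=1}^{M} Σ_{p=0}^{L−1} g_m(t_p, τ) y_m(t − t_p), and the mean square error ς(f, N, τ) = (1/(2π)) ∫₀^{2π} | f(t − τ) − T_N f_τ(t) |² dt. Then the phase-averaged error satisfies (L/(2π)) ∫₀^{2π/L} ς(f, N, τ) dτ = Σ_{n∉I^N} |a(n)|² + Σ_{k∈ℤ, k∉{1,…,M}} Σ_{n∈I_k} |a(n)|² · Σ_{l=1}^{M} | Σ_{m=1}^{M} r_m(n + (l−k)L) b_m(n) |². -/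
open Real MeasureTheory

/-- Parseval's identity on `[0, 2π]`, with explicit Fourier integrals. -/
theorem hasSum_sq_norm_fourierIntegral {g : ℝ → ℂ}
    (hg : MemLp g 2 (volume.restrict (Set.Ioc 0 (2 * π)))) :
    HasSum (fun n : ℤ => ‖(1 / (2 * (π : ℂ))) *
        ∫ t in (0 : ℝ)..(2 * π), g t * Complex.exp (-Complex.I * (n : ℂ) * (t : ℂ))‖ ^ 2)
      ((1 / (2 * π)) * ∫ t in (0 : ℝ)..(2 * π), ‖g t‖ ^ 2) := by
  have h := hasSum_sq_fourierCoeffOn two_pi_pos hg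
  simp only [sub_zero, smul_eq_mul, ← one_div] at h
  convert h using 4 with n
  rw [fourierCoeffOn_eq_integral, Complex.real_smul]
  congr 1
  · push_cast; simp
  · refine intervalIntegral.integral_congr fun t _ => ?_
    have hpi : (π : ℂ) ≠ 0 := by exact_mod_cast pi_ne_zero
    rw [fourier_coe_apply, smul_eq_mul, mul_comm]
    congr 2
    push_cast
    field_simp
    ring

theorem integral_exp_int_mul_I (k : ℤ) :
    (1 / (2 * (π : ℂ))) * ∫ t in (0 : ℝ)..(2 * π), Complex.exp (Complex.I * (k : ℂ) * (t : ℂ)) =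
      if k = 0 then 1 else 0 := by
  have hpi : (π : ℂ) ≠ 0 := by exact_mod_cast pi_ne_zero
  split_ifs with hk
  · subst hk
    simp
    field_simp
  · have hk' : (k : ℂ) ≠ 0 := by exact_mod_cast hk
    rw [integral_exp_mul_complex (mul_ne_zero Complex.I_ne_zero hk')]
    have : Complex.exp (Complex.I * k * ((2 * π : ℝ) : ℂ)) = 1 := by
      rw [Complex.exp_eq_one_iff]
      exact ⟨k, by push_cast; ring⟩
    rw [this]
    simp

theorem sum_exp_two_pi_div {L : ℕ} (hL : 0 < L) (k : ℤ) :
    ∑ p ∈ Finset.range L, Complex.exp (Complex.I * (k : ℂ) * ((2 * π * p / L : ℝ) : ℂ)) =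
      if (L : ℤ) ∣ k then (L : ℂ) else 0 := by
  have hpi : (π : ℂ) ≠ 0 := by exact_mod_cast pi_ne_zero
  have hL' : (L : ℂ) ≠ 0 := by exact_mod_cast hL.ne'
  set z := Complex.exp (Complex.I * k * (2 * π / L)) with hz
  have hpow : ∀ p : ℕ,
      Complex.exp (Complex.I * (k : ℂ) * ((2 * π * p / L : ℝ) : ℂ)) = z ^ p := by
    intro p
    rw [hz, ← Complex.exp_nat_mul]
    congr 1
    push_cast
    ring
  simp only [hpow]
  have hz1 : z = 1 ↔ (L : ℤ) ∣ k := by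
    rw [hz, Complex.exp_eq_one_iff]
    constructor
    · rintro ⟨n, hn⟩
      refine ⟨n, ?_⟩
      have : (k : ℂ) = L * n := by
        field_simp at hn
        exact hn
      exact_mod_cast this
    · rintro ⟨n, rfl⟩
      refine ⟨n, ?_⟩
      push_cast
      field_simp
  split_ifs with h
  · simp [hz1.2 h]
  · have hne : z ≠ 1 := fun h1 => h (hz1.1 h1)
    rw [geom_sum_eq hne]
    have : z ^ L = 1 := by
      rw [hz, ← Complex.exp_nat_mul, Complex.exp_eq_one_iff]
      exact ⟨k, by field_simp⟩
    simp [this]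

theorem norm_exp_I_int_mul (k : ℤ) (t : ℝ) :
    ‖Complex.exp (Complex.I * (k : ℂ) * (t : ℂ))‖ = 1 := by
  rw [show Complex.I * (k : ℂ) * (t : ℂ) = ((k * t : ℝ) : ℂ) * Complex.I by push_cast; ring]
  exact Complex.norm_exp_ofReal_mul_I _

theorem continuous_tsum_mul_exp {d : ℤ → ℂ} (hd : Summable fun s => ‖d s‖) :
    Continuous fun u : ℝ => ∑' s : ℤ, d s * Complex.exp (Complex.I * (s : ℂ) * (u : ℂ)) := by
  refine continuous_tsum (fun s => by fun_prop) hd fun s u => ?_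
  rw [norm_mul, norm_exp_I_int_mul, mul_one]

theorem memLp_two_of_continuous {g : ℝ → ℂ} (hg : Continuous g) (a b : ℝ) :
    MemLp g 2 (volume.restrict (Set.Ioc a b)) := by
  rw [memLp_two_iff_integrable_sq_norm hg.aestronglyMeasurable]
  exact (Continuous.integrableOn_Ioc (by fun_prop))

theorem fourierIntegral_tsum {d : ℤ → ℂ} (hd : Summable fun s => ‖d s‖) (n : ℤ) :
    (1 / (2 * (π : ℂ))) * ∫ t in (0 : ℝ)..(2 * π),
      (∑' s : ℤ, d s * Complex.exp (Complex.I * (s : ℂ) * (t : ℂ))) *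
        Complex.exp (-Complex.I * (n : ℂ) * (t : ℂ)) = d n := by
  have hterm : ∀ (s : ℤ) (t : ℝ), d s * Complex.exp (Complex.I * (s : ℂ) * (t : ℂ)) *
      Complex.exp (-Complex.I * (n : ℂ) * (t : ℂ)) =
      d s * Complex.exp (Complex.I * ((s - n : ℤ) : ℂ) * (t : ℂ)) := by
    intro s t
    rw [mul_assoc, ← Complex.exp_add]
    congr 2
    push_cast
    ring
  have hsum := intervalIntegral.hasSum_integral_of_dominated_convergence
    (μ := volume) (a := 0) (b := 2 * π)
    (F := fun (s : ℤ) (t : ℝ) => d s * Complex.exp (Complex.I * ((s - n : ℤ) : ℂ) * (t : ℂ)))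
    (f := fun t : ℝ => (∑' s : ℤ, d s * Complex.exp (Complex.I * (s : ℂ) * (t : ℂ))) *
        Complex.exp (-Complex.I * (n : ℂ) * (t : ℂ)))
    (fun s _ => ‖d s‖)
    (fun s => Continuous.aestronglyMeasurable (by fun_prop))
    (fun s => .of_forall fun t _ => by rw [norm_mul, norm_exp_I_int_mul, mul_one])
    (.of_forall fun t _ => hd) (by simp)
    (.of_forall fun t _ => by
      simp only [← hterm]
      refine (Summable.hasSum ?_).mul_right _
      refine Summable.of_norm ?_
      simpa only [norm_mul, norm_exp_I_int_mul, mul_one] using hd)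
  have h2 := hsum.mul_left (1 / (2 * (π : ℂ)))
  rw [← h2.tsum_eq, tsum_eq_single n]
  · rw [intervalIntegral.integral_const_mul, mul_left_comm, integral_exp_int_mul_I]
    simp
  · intro s hs
    rw [intervalIntegral.integral_const_mul, mul_left_comm, integral_exp_int_mul_I,
      if_neg (sub_ne_zero.2 hs), mul_zero]

theorem mean_sq_norm_tsum_exp {d : ℤ → ℂ} (hd : Summable fun s => ‖d s‖) :
    (1 / (2 * π)) * ∫ u in (0 : ℝ)..(2 * π),
      ‖∑' s : ℤ, d s * Complex.exp (Complex.I * (s : ℂ) * (u : ℂ))‖ ^ 2 = ∑' s, ‖d s‖ ^ 2 := by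
  have h := hasSum_sq_norm_fourierIntegral
    (memLp_two_of_continuous (continuous_tsum_mul_exp hd) 0 (2 * π))
  simp only [fourierIntegral_tsum hd] at h
  exact h.tsum_eq.symm

theorem mean_sq_norm_tsum_exp_mul {L : ℕ} (hL : 0 < L) {d : ℤ → ℂ}
    (hd : Summable fun s => ‖d s‖) :
    ((L : ℝ) / (2 * π)) * ∫ τ in (0 : ℝ)..(2 * π / L),
      ‖∑' s : ℤ, d s * Complex.exp (-Complex.I * (s : ℂ) * (L * τ : ℂ))‖ ^ 2 =
      ∑' s, ‖d s‖ ^ 2 := by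
  have hL' : (L : ℝ) ≠ 0 := by exact_mod_cast hL.ne'
  have hd' : Summable fun s => ‖d (-s)‖ := (Equiv.neg ℤ).summable_iff.2 hd
  have h := mean_sq_norm_tsum_exp hd'
  rw [← (Equiv.neg ℤ).tsum_eq (fun s => ‖d s‖ ^ 2)]
  simp only [Equiv.neg_apply]
  rw [← h]
  have h2 := intervalIntegral.mul_integral_comp_mul_left (a := 0)
    (b := 2 * π / L)
    (c := (L : ℝ))
    (f := fun u : ℝ => ‖∑' s : ℤ, d (-s) * Complex.exp (Complex.I * (s : ℂ) * (u : ℂ))‖ ^ 2)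
  rw [mul_zero, mul_div_cancel₀ _ hL'] at h2
  rw [← h2, ← mul_assoc, one_div_mul_eq_div]
  congr 1
  refine intervalIntegral.integral_congr fun t _ => ?_
  rw [← (Equiv.neg ℤ).tsum_eq]
  congr 4 with s
  simp

theorem memLp_two_comp_sub {f : ℝ → ℂ} (hper : ∀ t : ℝ, f (t + 2 * π) = f t)
    (hmeas : AEStronglyMeasurable f volume)
    (hL2 : IntervalIntegrable (fun t : ℝ => ‖f t‖ ^ 2) volume 0 (2 * π)) (τ : ℝ) :
    MemLp (fun t => f (t - τ)) 2 (volume.restrict (Set.Ioc 0 (2 * π))) := by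
  have hm : AEStronglyMeasurable (fun t => f (t - τ)) volume :=
    hmeas.comp_measurePreserving (measurePreserving_sub_right volume τ)
  rw [memLp_two_iff_integrable_sq_norm hm.restrict]
  have hp : Function.Periodic (fun t : ℝ => ‖f t‖ ^ 2) (2 * π) := fun t => by simp only [hper]
  have h := (hp.intervalIntegrable₀ two_pi_pos.ne' hL2 (0 - τ) (2 * π - τ)).comp_sub_right τ
  simp only [sub_add_cancel] at h
  exact (intervalIntegrable_iff_integrableOn_Ioc_of_le two_pi_pos.le).1 h

theorem integral_comp_sub_mul_exp {f : ℝ → ℂ} (hper : ∀ t : ℝ, f (t + 2 * π) = f t)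
    (τ : ℝ) (n : ℤ) :
    ∫ t in (0 : ℝ)..(2 * π), f (t - τ) * Complex.exp (-Complex.I * (n : ℂ) * (t : ℂ)) =
      (∫ t in (0 : ℝ)..(2 * π), f t * Complex.exp (-Complex.I * (n : ℂ) * (t : ℂ))) *
        Complex.exp (-Complex.I * (n : ℂ) * (τ : ℂ)) := by
  have hp : Function.Periodic
      (fun t : ℝ => f t * Complex.exp (-Complex.I * (n : ℂ) * (t : ℂ))) (2 * π) := by
    intro t
    simp only [hper]
    congr 1
    rw [Complex.exp_eq_exp_iff_exists_int]
    exact ⟨-n, by push_cast; ring⟩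
  have h1 := hp.intervalIntegral_add_eq 0 (0 - τ)
  rw [zero_add, show 0 - τ + 2 * π = 2 * π - τ by ring,
    ← intervalIntegral.integral_comp_sub_right] at h1
  rw [h1, ← intervalIntegral.integral_mul_const]
  refine intervalIntegral.integral_congr fun t _ => ?_
  rw [mul_assoc (f _), ← Complex.exp_add]
  congr 2
  push_cast
  ring

theorem mean_sq_error_trigPoly {f : ℝ → ℂ} (hper : ∀ t : ℝ, f (t + 2 * π) = f t)
    (hmeas : AEStronglyMeasurable f volume)
    (hL2 : IntervalIntegrable (fun t : ℝ => ‖f t‖ ^ 2) volume 0 (2 * π)) {a : ℤ → ℂ}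
    (ha : ∀ n : ℤ, a n = (1 / (2 * (π : ℂ))) *
      ∫ t in (0 : ℝ)..(2 * π), f t * Complex.exp (-Complex.I * (n : ℂ) * (t : ℂ)))
    (S : Finset ℤ) (D : ℤ → ℂ) (τ : ℝ) :
    (1 / (2 * π)) * ∫ t in (0 : ℝ)..(2 * π),
      ‖f (t - τ) - ∑ j ∈ S, Complex.exp (Complex.I * (j : ℂ) * (t : ℂ)) * D j‖ ^ 2 =
    (∑' n : ℤ, if n ∈ S then 0 else ‖a n‖ ^ 2) +
      ∑ j ∈ S, ‖a j * Complex.exp (-Complex.I * (j : ℂ) * (τ : ℂ)) - D j‖ ^ 2 := by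
  have hfm := memLp_two_comp_sub hper hmeas hL2 τ
  have hTc : Continuous fun t : ℝ =>
      ∑ j ∈ S, Complex.exp (Complex.I * (j : ℂ) * (t : ℂ)) * D j := by fun_prop
  have h := hasSum_sq_norm_fourierIntegral (hfm.sub (memLp_two_of_continuous hTc 0 (2 * π)))
  have hfi : IntervalIntegrable (fun t => f (t - τ)) volume 0 (2 * π) :=
    (intervalIntegrable_iff_integrableOn_Ioc_of_le two_pi_pos.le).2 (hfm.integrable one_le_two)
  have hcoef : ∀ n : ℤ, (1 / (2 * (π : ℂ))) * ∫ t in (0 : ℝ)..(2 * π),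
      ((fun t => f (t - τ)) - fun t : ℝ =>
        ∑ j ∈ S, Complex.exp (Complex.I * (j : ℂ) * (t : ℂ)) * D j) t *
        Complex.exp (-Complex.I * (n : ℂ) * (t : ℂ)) =
      a n * Complex.exp (-Complex.I * (n : ℂ) * (τ : ℂ)) - if n ∈ S then D n else 0 := by
    intro n
    simp only [Pi.sub_apply, sub_mul]
    rw [intervalIntegral.integral_sub, mul_sub, integral_comp_sub_mul_exp hper, ← mul_assoc,
      ← ha]
    · congr 1
      simp only [Finset.sum_mul]
      rw [intervalIntegral.integral_finsetSum
        fun j _ => Continuous.intervalIntegrable (by fun_prop) _ _, Finset.mul_sum,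
        ← Finset.sum_ite_eq S n D]
      refine Finset.sum_congr rfl fun j _ => ?_
      have hterm : ∀ t : ℝ, Complex.exp (Complex.I * (j : ℂ) * (t : ℂ)) * D j *
          Complex.exp (-Complex.I * (n : ℂ) * (t : ℂ)) =
          D j * Complex.exp (Complex.I * ((j - n : ℤ) : ℂ) * (t : ℂ)) := by
        intro t
        rw [mul_comm _ (D j), mul_assoc, ← Complex.exp_add]
        congr 2
        push_cast
        ring
      simp only [hterm]
      rw [intervalIntegral.integral_const_mul, mul_left_comm, integral_exp_int_mul_I]
      simp only [sub_eq_zero, mul_ite, mul_one, mul_zero, eq_comm]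
    · exact hfi.mul_continuousOn (Continuous.continuousOn (by fun_prop))
    · exact Continuous.intervalIntegrable (by fun_prop) _ _
  simp only [hcoef] at h
  simp only [Pi.sub_apply] at h
  have h2 := h.sub (hasSum_sum_of_ne_finset_zero (s := S) (f := fun n => if n ∈ S then
    ‖a n * Complex.exp (-Complex.I * (n : ℂ) * (τ : ℂ)) - D n‖ ^ 2 else 0)
    fun n hn => if_neg hn)
  rw [← sub_eq_iff_eq_add, ← Finset.sum_congr rfl fun j hj => if_pos hj, ← h2.tsum_eq]
  refine tsum_congr fun n => ?_
  have hexp : ‖Complex.exp (-Complex.I * (n : ℂ) * (τ : ℂ))‖ = 1 := by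
    simpa using norm_exp_I_int_mul (-n) τ
  split_ifs
  · exact sub_self _
  · rw [sub_zero, sub_zero, norm_mul, hexp, mul_one]

/-- Sampling at the points `2πp/L` folds frequencies congruent modulo `L`. -/
theorem sum_sample_mul_exp {L : ℕ} (hL : 0 < L) {c : ℤ → ℂ} (hc : Summable fun n => ‖c n‖)
    (j : ℤ) (t : ℝ) :
    ∑ p ∈ Finset.range L,
      (∑' n : ℤ, c n * Complex.exp (Complex.I * (n : ℂ) * ((2 * π * p / L : ℝ) : ℂ))) *
        Complex.exp (Complex.I * (j : ℂ) * ((t - 2 * π * p / L : ℝ) : ℂ)) =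
    (L : ℂ) * (Complex.exp (Complex.I * (j : ℂ) * (t : ℂ)) * ∑' s : ℤ, c (j + s * L)) := by
  have hL' : (L : ℤ) ≠ 0 := by exact_mod_cast hL.ne'
  have hS : ∀ x : ℝ, Summable fun n : ℤ => c n * Complex.exp (Complex.I * (n : ℂ) * (x : ℂ)) := by
    intro x
    refine Summable.of_norm ?_
    simpa only [norm_mul, norm_exp_I_int_mul, mul_one] using hc
  simp only [← tsum_mul_right]
  rw [← Summable.tsum_finsetSum fun p _ => (hS _).mul_right _]
  have hterm : ∀ n : ℤ, ∑ p ∈ Finset.range L,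
      c n * Complex.exp (Complex.I * (n : ℂ) * ((2 * π * p / L : ℝ) : ℂ)) *
        Complex.exp (Complex.I * (j : ℂ) * ((t - 2 * π * p / L : ℝ) : ℂ)) =
      L * (Complex.exp (Complex.I * (j : ℂ) * (t : ℂ)) * if (L : ℤ) ∣ n - j then c n else 0) := by
    intro n
    have : ∀ p : ℕ, c n * Complex.exp (Complex.I * (n : ℂ) * ((2 * π * p / L : ℝ) : ℂ)) *
        Complex.exp (Complex.I * (j : ℂ) * ((t - 2 * π * p / L : ℝ) : ℂ)) =
        c n * Complex.exp (Complex.I * (j : ℂ) * (t : ℂ)) *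
          Complex.exp (Complex.I * ((n - j : ℤ) : ℂ) * ((2 * π * p / L : ℝ) : ℂ)) := by
      intro p
      rw [mul_assoc (c n), mul_assoc (c n), ← Complex.exp_add, ← Complex.exp_add]
      congr 2
      push_cast
      ring
    simp only [this]
    rw [← Finset.mul_sum, sum_exp_two_pi_div hL]
    split_ifs <;> ring
  simp only [hterm]
  rw [tsum_mul_left, tsum_mul_left]
  congr 2
  have hinj : Function.Injective fun s : ℤ => j + s * (L : ℤ) := fun s s' h =>
    mul_right_cancel₀ hL' (add_left_cancel h)
  rw [← hinj.tsum_eq]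
  · refine tsum_congr fun s => if_pos ?_
    simp
  · intro n hn
    by_contra hcon
    refine hn (if_neg fun ⟨s, hs⟩ => hcon ⟨s, ?_⟩)
    simp only
    linarith

theorem sum_Icc_eq_sum_blocks {N₁ N₂ : ℤ} {M L : ℕ} (hL : 0 < L)
    (hNML : N₂ - N₁ + 1 = (L : ℤ) * (M : ℤ)) (G : ℤ → ℝ) :
    ∑ j ∈ Finset.Icc N₁ N₂, G j =
      ∑ q ∈ Finset.Ico (0 : ℤ) L, ∑ l ∈ Finset.Icc (1 : ℤ) M, G (N₁ + (l - 1) * L + q) := by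
  have hL' : (0 : ℤ) < L := by exact_mod_cast hL
  rw [← Finset.sum_product']
  symm
  refine Finset.sum_bij' (fun x _ => N₁ + (x.2 - 1) * L + x.1)
    (fun j _ => ((j - N₁) % L, (j - N₁) / L + 1)) ?_ ?_ ?_ ?_ ?_
  · rintro ⟨q, l⟩ h
    simp only [Finset.mem_product, Finset.mem_Ico, Finset.mem_Icc] at h ⊢
    constructor <;> nlinarith
  · intro j h
    simp only [Finset.mem_product, Finset.mem_Ico, Finset.mem_Icc] at h ⊢
    refine ⟨⟨Int.emod_nonneg _ hL'.ne', Int.emod_lt_of_pos _ hL'⟩, ?_, ?_⟩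
    · have := Int.ediv_nonneg (show 0 ≤ j - N₁ by linarith) hL'.le
      linarith
    · have : (j - N₁) / L < M := Int.ediv_lt_of_lt_mul hL' (by linarith)
      linarith
  · rintro ⟨q, l⟩ h
    simp only [Finset.mem_product, Finset.mem_Ico, Finset.mem_Icc] at h
    have e : N₁ + (l - 1) * L + q - N₁ = q + (l - 1) * L := by ring
    simp only [e]
    rw [Int.add_mul_emod_self_right, Int.add_mul_ediv_right _ _ hL'.ne',
      Int.emod_eq_of_lt h.1.1 h.1.2, Int.ediv_eq_zero_of_lt h.1.1 h.1.2]
    simp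
  · intro j h
    simp only
    have := Int.emod_add_mul_ediv (j - N₁) L
    linear_combination this
  · intro x _
    rfl

/-- The interpolation filters are biorthogonal to the sampling filters on the passband. -/
theorem sum_inv_mul_eq_ite {N₁ N₂ : ℤ} {M L : ℕ} (hL : 0 < L)
    (hNML : N₂ - N₁ + 1 = (L : ℤ) * (M : ℤ)) {b r : Fin M → ℤ → ℂ}
    {H : ℤ → Matrix (Fin M) (Fin M) ℂ}
    (hH : ∀ n : ℤ, H n = Matrix.of fun j k : Fin M => b k (n + (j : ℤ) * (L : ℤ)))
    (hinv : ∀ n : ℤ, N₁ ≤ n → n ≤ N₁ + (L : ℤ) - 1 → IsUnit (H n))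
    (hr1 : ∀ (m : Fin M) (n : ℤ), N₁ ≤ n → n ≤ N₁ + (L : ℤ) - 1 →
      ∀ k : Fin M, r m (n + (k : ℤ) * (L : ℤ)) = (H n)⁻¹ m k)
    {j s : ℤ} (hj : j ∈ Finset.Icc N₁ N₂) (hjs : j + s * L ∈ Finset.Icc N₁ N₂) :
    ∑ m : Fin M, r m j * b m (j + s * L) = if s = 0 then 1 else 0 := by
  have hL' : (0 : ℤ) < L := by exact_mod_cast hL
  rw [Finset.mem_Icc] at hj hjs
  have key : ∀ i : ℤ, N₁ ≤ i → i ≤ N₂ → ∃ k : Fin M, (k : ℤ) = (i - N₁) / L := by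
    intro i h1 h2
    have h0 := Int.ediv_nonneg (show 0 ≤ i - N₁ by linarith) hL'.le
    have hM' : (i - N₁) / L < M := Int.ediv_lt_of_lt_mul hL' (by linarith)
    exact ⟨⟨((i - N₁) / L).toNat, by omega⟩, by simpa using h0⟩
  obtain ⟨k, hk⟩ := key j hj.1 hj.2
  obtain ⟨k', hk'⟩ := key _ hjs.1 hjs.2
  have hkk : (k' : ℤ) = k + s := by
    rw [hk, hk', ← Int.add_mul_ediv_right _ _ hL'.ne']
    congr 1
    ring
  set n := N₁ + (j - N₁) % L with hn
  have hn1 : N₁ ≤ n := by have := Int.emod_nonneg (j - N₁) hL'.ne'; linarith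
  have hn2 : n ≤ N₁ + L - 1 := by have := Int.emod_lt_of_pos (j - N₁) hL'; omega
  have hjn : j = n + k * L := by
    have := Int.emod_add_mul_ediv (j - N₁) L
    rw [hn, hk]
    linear_combination -this
  have hjsn : j + s * L = n + k' * L := by
    rw [hkk, hjn]
    ring
  have hmul : (H n * (H n)⁻¹) k' k = if s = 0 then 1 else 0 := by
    rw [Matrix.mul_nonsing_inv _ ((Matrix.isUnit_iff_isUnit_det _).1 (hinv n hn1 hn2)),
      Matrix.one_apply]
    congr 1
    rw [Fin.ext_iff, eq_iff_iff]
    omega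
  rw [← hmul, Matrix.mul_apply, hjsn]
  refine Finset.sum_congr rfl fun m _ => ?_
  rw [hjn, hr1 m n hn1 hn2 k, mul_comm]
  congr 1
  rw [hH, Matrix.of_apply]

/-- Theorem 4.2: exact expression for the phase-averaged mean square error of the
MCI approximation of a (not necessarily bandlimited) square-integrable
`2π`-periodic signal. -/
theorem mci_averaged_error_formula
    (N₁ N₂ : ℤ) (M L : ℕ) (hM : 0 < M) (hL : 0 < L)
    (hNML : N₂ - N₁ + 1 = (L : ℤ) * (M : ℤ))
    (b : Fin M → ℤ → ℂ)
    (H : ℤ → Matrix (Fin M) (Fin M) ℂ)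
    (hH : ∀ n : ℤ, H n = Matrix.of fun j k : Fin M => b k (n + (j : ℤ) * (L : ℤ)))
    (hinv : ∀ n : ℤ, N₁ ≤ n → n ≤ N₁ + (L : ℤ) - 1 → IsUnit (H n))
    (r : Fin M → ℤ → ℂ)
    (hr1 : ∀ (m : Fin M) (n : ℤ), N₁ ≤ n → n ≤ N₁ + (L : ℤ) - 1 →
      ∀ k : Fin M, r m (n + (k : ℤ) * (L : ℤ)) = (H n)⁻¹ m k)
    (hr0 : ∀ (m : Fin M) (n : ℤ), n < N₁ ∨ N₂ < n → r m n = 0)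
    (y : Fin M → ℝ → ℂ)
    (hy : ∀ (m : Fin M) (t : ℝ),
      y m t = ∑ n ∈ Finset.Icc N₁ N₂, r m n * Complex.exp (Complex.I * (n : ℂ) * (t : ℂ)))
    (f : ℝ → ℂ)
    (hper : ∀ t : ℝ, f (t + 2 * π) = f t)
    (hmeas : AEStronglyMeasurable f volume)
    (hL2 : IntervalIntegrable (fun t : ℝ => ‖f t‖ ^ 2) volume 0 (2 * π))
    (a : ℤ → ℂ)
    (ha : ∀ n : ℤ, a n = (1 / (2 * (π : ℂ))) *
      ∫ t in (0 : ℝ)..(2 * π), f t * Complex.exp (-Complex.I * (n : ℂ) * (t : ℂ)))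
    (hsum : ∀ m : Fin M, Summable fun n : ℤ => ‖a n * b m n‖)
    (T : ℝ → ℝ → ℂ)
    (hT : ∀ (τ t : ℝ), T τ t = (1 / (L : ℂ)) * ∑ m : Fin M, ∑ p ∈ Finset.range L,
      (∑' n : ℤ, a n * b m n * Complex.exp (-Complex.I * (n : ℂ) * (τ : ℂ)) *
        Complex.exp (Complex.I * (n : ℂ) * ((2 * π * p / L : ℝ) : ℂ))) *
      y m (t - 2 * π * p / L))
    (ς : ℝ → ℝ)
    (hς : ∀ τ : ℝ, ς τ = (1 / (2 * π)) *
      ∫ t in (0 : ℝ)..(2 * π), ‖f (t - τ) - T τ t‖ ^ 2) :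
    ((L : ℝ) / (2 * π)) * ∫ τ in (0 : ℝ)..(2 * π / L), ς τ =
      (∑' n : ℤ, if n ∈ Finset.Icc N₁ N₂ then 0 else ‖a n‖ ^ 2) +
      ∑' k : ℤ, (if 1 ≤ k ∧ k ≤ (M : ℤ) then 0 else
        ∑ n ∈ Finset.Icc (N₁ + (k - 1) * (L : ℤ)) (N₁ + k * (L : ℤ) - 1),
          ‖a n‖ ^ 2 * ∑ l ∈ Finset.Icc (1 : ℤ) (M : ℤ),
            ‖∑ m : Fin M, r m (n + (l - k) * (L : ℤ)) * b m n‖ ^ 2) := by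
  have hL' : (L : ℤ) ≠ 0 := by exact_mod_cast hL.ne'
  set S := Finset.Icc N₁ N₂ with hS
  set W : ℤ → ℤ → ℂ := fun j s => ∑ m : Fin M, r m j * b m (j + s * L) with hW
  set e : ℤ → ℤ → ℂ := fun j s =>
    if j + s * L ∈ S then 0 else a (j + s * L) * W j s with he
  set D : ℤ → ℝ → ℂ := fun j τ => ∑ m : Fin M, r m j * ∑' s : ℤ,
    a (j + s * L) * b m (j + s * L) *
      Complex.exp (-Complex.I * ((j + s * L : ℤ) : ℂ) * (τ : ℂ)) with hD
  have hexp : ∀ (n : ℤ) (τ : ℝ), ‖Complex.exp (-Complex.I * (n : ℂ) * (τ : ℂ))‖ = 1 := by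
    intro n τ
    simpa using norm_exp_I_int_mul (-n) τ
  have hsumτ : ∀ (m : Fin M) (τ : ℝ), Summable fun n : ℤ =>
      ‖a n * b m n * Complex.exp (-Complex.I * (n : ℂ) * (τ : ℂ))‖ := by
    intro m τ
    simpa only [norm_mul _ (Complex.exp _), hexp, mul_one] using hsum m
  have hinj : ∀ j : ℤ, Function.Injective fun s : ℤ => j + s * (L : ℤ) := fun j s s' h =>
    mul_right_cancel₀ hL' (add_left_cancel h)
  have hT' : ∀ τ t : ℝ, T τ t = ∑ j ∈ S, Complex.exp (Complex.I * (j : ℂ) * (t : ℂ)) * D j τ := by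
    intro τ t
    have hLC : (L : ℂ) ≠ 0 := by exact_mod_cast hL.ne'
    have hm : ∀ m : Fin M, ∑ p ∈ Finset.range L,
        (∑' n : ℤ, a n * b m n * Complex.exp (-Complex.I * (n : ℂ) * (τ : ℂ)) *
          Complex.exp (Complex.I * (n : ℂ) * ((2 * π * p / L : ℝ) : ℂ))) *
        y m (t - 2 * π * p / L) =
        ∑ j ∈ S, (L : ℂ) * (Complex.exp (Complex.I * (j : ℂ) * (t : ℂ)) * (r m j * ∑' s : ℤ,
          a (j + s * L) * b m (j + s * L) *
            Complex.exp (-Complex.I * ((j + s * L : ℤ) : ℂ) * (τ : ℂ)))) := by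
      intro m
      simp only [hy, Finset.mul_sum]
      rw [Finset.sum_comm]
      refine Finset.sum_congr rfl fun j _ => ?_
      simp only [mul_left_comm _ (r m j)]
      rw [← Finset.mul_sum, sum_sample_mul_exp hL (hsumτ m τ)]
    rw [hT]
    simp only [hm, ← Finset.mul_sum]
    rw [← mul_assoc, one_div_mul_cancel hLC, one_mul, Finset.sum_comm]
    simp only [hD, Finset.mul_sum]
  have haW : ∀ j, Summable fun s : ℤ => ‖a (j + s * L) * W j s‖ := by
    intro j
    have h1 : Summable fun s : ℤ => ∑ m : Fin M,
        ‖r m j‖ * ‖a (j + s * L) * b m (j + s * L)‖ :=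
      summable_sum fun m _ => ((hsum m).comp_injective (hinj j)).mul_left _
    refine Summable.of_nonneg_of_le (fun _ => norm_nonneg _) (fun s => ?_) h1
    simp only [hW, Finset.mul_sum]
    refine (norm_sum_le _ _).trans (Finset.sum_le_sum fun m _ => ?_)
    rw [← norm_mul, mul_left_comm]
  have hes : ∀ j, Summable fun s : ℤ => ‖e j s‖ := by
    intro j
    refine Summable.of_nonneg_of_le (fun _ => norm_nonneg _) (fun s => ?_) (haW j)
    simp only [he]
    split_ifs
    · rw [norm_zero]
      exact norm_nonneg _
    · exact le_rfl
  have hDe : ∀ j ∈ S, ∀ τ : ℝ, a j * Complex.exp (-Complex.I * (j : ℂ) * (τ : ℂ)) - D j τ =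
      -(Complex.exp (-Complex.I * (j : ℂ) * (τ : ℂ)) *
        ∑' s : ℤ, e j s * Complex.exp (-Complex.I * (s : ℂ) * (L * τ : ℂ))) := by
    intro j hj τ
    have h1 : HasSum (fun s : ℤ => ∑ m : Fin M, r m j * (a (j + s * L) * b m (j + s * L) *
        Complex.exp (-Complex.I * ((j + s * L : ℤ) : ℂ) * (τ : ℂ)))) (D j τ) :=
      hasSum_sum fun m _ =>
        (((hsumτ m τ).of_norm.comp_injective (hinj j)).hasSum).mul_left _
    have h2 := (hasSum_ite_eq (0 : ℤ)
      (a j * Complex.exp (-Complex.I * (j : ℂ) * (τ : ℂ)))).sub h1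
    rw [← h2.tsum_eq, ← tsum_mul_left, ← tsum_neg]
    refine tsum_congr fun s => ?_
    have h3 : ∑ m : Fin M, r m j * (a (j + s * L) * b m (j + s * L) *
        Complex.exp (-Complex.I * ((j + s * L : ℤ) : ℂ) * (τ : ℂ))) =
        a (j + s * L) * W j s * Complex.exp (-Complex.I * (j : ℂ) * (τ : ℂ)) *
          Complex.exp (-Complex.I * (s : ℂ) * (L * τ : ℂ)) := by
      rw [mul_assoc _ (Complex.exp _), ← Complex.exp_add]
      simp only [hW, Finset.mul_sum, Finset.sum_mul]
      refine Finset.sum_congr rfl fun m _ => ?_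
      rw [show -Complex.I * (j : ℂ) * (τ : ℂ) + -Complex.I * (s : ℂ) * (L * τ : ℂ) =
        -Complex.I * ((j + s * L : ℤ) : ℂ) * (τ : ℂ) by push_cast; ring]
      ring
    rw [h3]
    by_cases hjs : j + s * L ∈ S
    · have hWj : W j s = if s = 0 then 1 else 0 :=
        sum_inv_mul_eq_ite hL hNML hH hinv hr1 hj hjs
      simp only [he, if_pos hjs, hWj]
      split_ifs with hs <;> simp [hs]
    · have hs : s ≠ 0 := by
        rintro rfl
        exact hjs (by simpa using hj)
      simp only [he, if_neg hjs, if_neg hs]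
      ring
  have hς' : ∀ τ : ℝ, ς τ = (∑' n : ℤ, if n ∈ S then 0 else ‖a n‖ ^ 2) +
      ∑ j ∈ S, ‖∑' s : ℤ, e j s * Complex.exp (-Complex.I * (s : ℂ) * (L * τ : ℂ))‖ ^ 2 := by
    intro τ
    rw [hς]
    simp only [hT']
    rw [mean_sq_error_trigPoly hper hmeas hL2 ha]
    congr 1
    refine Finset.sum_congr rfl fun j hj => ?_
    rw [hDe j hj, norm_neg, norm_mul, hexp, one_mul]
  have hcont : ∀ j, Continuous fun τ : ℝ =>
      ‖∑' s : ℤ, e j s * Complex.exp (-Complex.I * (s : ℂ) * (L * τ : ℂ))‖ ^ 2 := by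
    intro j
    refine (Continuous.norm (continuous_tsum (fun s => by fun_prop) (hes j)
      fun s τ => ?_)).pow 2
    have := hexp s (L * τ)
    push_cast at this
    rw [norm_mul, this, mul_one]
  have havg : ((L : ℝ) / (2 * π)) * ∫ τ in (0 : ℝ)..(2 * π / L), ς τ =
      (∑' n : ℤ, if n ∈ S then 0 else ‖a n‖ ^ 2) + ∑ j ∈ S, ∑' s, ‖e j s‖ ^ 2 := by
    simp only [hς']
    rw [intervalIntegral.integral_add (by simp)
        (Continuous.intervalIntegrable (continuous_finsetSum _ fun j _ => hcont j) _ _),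
      intervalIntegral.integral_finsetSum
        fun j _ => Continuous.intervalIntegrable (hcont j) _ _, mul_add, Finset.mul_sum]
    congr 1
    · have hLR : (L : ℝ) ≠ 0 := by exact_mod_cast hL.ne'
      rw [intervalIntegral.integral_const, smul_eq_mul]
      field_simp
      simp
    · exact Finset.sum_congr rfl fun j _ => mean_sq_norm_tsum_exp_mul hL (hes j)
  rw [havg]
  congr 1
  rw [sum_Icc_eq_sum_blocks hL hNML]
  have he2 : ∀ j l : ℤ, Summable fun k : ℤ => ‖e j (k - l)‖ ^ 2 := by
    intro j l
    have h1 : Summable fun s : ℤ => ‖e j s‖ ^ 2 :=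
      (hasSum_sq_norm_fourierIntegral (memLp_two_of_continuous
        (continuous_tsum_mul_exp (hes j)) 0 (2 * π))).summable.congr fun n => by
          rw [fourierIntegral_tsum (hes j)]
    exact (Equiv.subRight l).summable_iff.2 h1
  have hshift : ∀ j l : ℤ, ∑' s, ‖e j s‖ ^ 2 = ∑' k, ‖e j (k - l)‖ ^ 2 := fun j l =>
    ((Equiv.subRight l).tsum_eq fun s => ‖e j s‖ ^ 2).symm
  have hblock : ∑ q ∈ Finset.Ico (0 : ℤ) L, ∑ l ∈ Finset.Icc (1 : ℤ) M,
      ∑' s, ‖e (N₁ + (l - 1) * L + q) s‖ ^ 2 =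
      ∑' k, ∑ q ∈ Finset.Ico (0 : ℤ) L, ∑ l ∈ Finset.Icc (1 : ℤ) M,
        ‖e (N₁ + (l - 1) * L + q) (k - l)‖ ^ 2 := by
    rw [Summable.tsum_finsetSum fun q _ => summable_sum fun l _ => he2 _ _]
    refine Finset.sum_congr rfl fun q _ => ?_
    rw [Summable.tsum_finsetSum fun l _ => he2 _ _]
    exact Finset.sum_congr rfl fun l _ => hshift _ l
  rw [hblock]
  refine tsum_congr fun k => ?_
  have hLpos : (0 : ℤ) < L := by exact_mod_cast hL
  have hidx : ∀ q l : ℤ, N₁ + (l - 1) * L + q + (k - l) * L = N₁ + (k - 1) * L + q := by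
    intro q l
    ring
  split_ifs with hk
  · refine Finset.sum_eq_zero fun q hq => Finset.sum_eq_zero fun l _ => ?_
    rw [Finset.mem_Ico] at hq
    have hmem : N₁ + (k - 1) * L + q ∈ S := by
      rw [hS, Finset.mem_Icc]
      constructor <;> nlinarith
    simp only [he, hidx, if_pos hmem]
    simp
  · have hnot : ∀ q ∈ Finset.Ico (0 : ℤ) L, N₁ + (k - 1) * L + q ∉ S := by
      intro q hq hmem
      rw [Finset.mem_Ico] at hq
      rw [hS, Finset.mem_Icc] at hmem
      refine hk ⟨?_, ?_⟩
      · by_contra hlt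
        nlinarith
      · by_contra hlt
        nlinarith
    refine Finset.sum_bij' (fun q _ => N₁ + (k - 1) * L + q)
      (fun n _ => n - (N₁ + (k - 1) * L)) ?_ ?_ ?_ ?_ ?_
    · intro q hq
      rw [Finset.mem_Ico] at hq
      rw [Finset.mem_Icc]
      constructor <;> linarith
    · intro n hn
      rw [Finset.mem_Icc] at hn
      rw [Finset.mem_Ico]
      constructor <;> linarith
    · intro q _
      ring
    · intro n _
      ring
    · intro q hq
      rw [Finset.mul_sum]
      refine Finset.sum_congr rfl fun l _ => ?_
      simp only [he, hW, hidx, if_neg (hnot q hq)]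
      rw [norm_mul, mul_pow, show N₁ + (k - 1) * L + q + (l - k) * L =
        N₁ + (l - 1) * L + q by ring]
end
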